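/- arXiv:1902.05133 — 4 statements merged into one kernel-verified Lean document; each statement's English description precedes it below -/
import Mathlib

section
/- Let X = {f = 0} ⊂ P³(K) be a smooth surface of degree d ≥ 3 over an algebraically closed field K of characteristic 0 or of characteristic p > d. Let L ⊆ X be a line of the second kind and let P ∈ L be a point such that the Hessian quadric V_P does not contain the projective tangent plane T_P X. Then the form t_P^(3) vanishes at every point of the set-theoretic intersection T_P X ∩ V_P. -/
open MvPolynomial

/-- The restriction of the polynomial `g` to the line through `[u]` spanned by `u` and `v`,
under the linear parametrization `t ↦ u + t • v`. -/
noncomputable def restrictLine {K : Type*} [CommSemiring K] {n : ℕ}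
    (g : MvPolynomial (Fin n) K) (u v : Fin n → K) : Polynomial K :=
  MvPolynomial.aeval (fun i => Polynomial.C (u i) + Polynomial.X * Polynomial.C (v i)) g

/-- `ordGE g u v k` means: the order of vanishing at the point `P = [u]` of the restriction
of `g` to the line spanned by `u` and `v` is at least `k` (this includes the case of the
identically vanishing restriction, i.e. order `∞`). -/
def ordGE {K : Type*} [CommSemiring K] {n : ℕ}
    (g : MvPolynomial (Fin n) K) (u v : Fin n → K) (k : ℕ) : Prop :=
  ∀ j < k, (restrictLine g u v).coeff j = 0

/-- `f` defines a smooth surface of degree `d` in `ℙ³(K)`: `f` is homogeneous of degree `d`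
and its four partial derivatives have no common zero in `ℙ³(K)`. -/
def IsSmoothSurfaceOfDegree {K : Type*} [CommSemiring K]
    (f : MvPolynomial (Fin 4) K) (d : ℕ) : Prop :=
  f.IsHomogeneous d ∧
    ∀ w : Fin 4 → K, w ≠ 0 → ∃ i : Fin 4, MvPolynomial.eval w (MvPolynomial.pderiv i f) ≠ 0

/-- A line in `ℙ³(K)` (the projectivization of a 2-dimensional linear subspace `W` of `K⁴`)
that is contained in the surface `{f = 0}`. -/
def IsLineInSurface {K : Type*} [Field K]
    (f : MvPolynomial (Fin 4) K) (W : Submodule K (Fin 4 → K)) : Prop :=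
  Module.finrank K W = 2 ∧ ∀ v ∈ W, MvPolynomial.eval v f = 0

/-- The form `t_P^{(j)}(z) = ∑_{0 ≤ i₁,…,i_j ≤ 3} (∂^j f/∂w_{i₁}⋯∂w_{i_j})(P) · z_{i₁}⋯z_{i_j}`. -/
noncomputable def tForm {K : Type*} [CommSemiring K]
    (f : MvPolynomial (Fin 4) K) (j : ℕ) (P : Fin 4 → K) : MvPolynomial (Fin 4) K :=
  ∑ s : Fin j → Fin 4,
    MvPolynomial.C
        (MvPolynomial.eval P ((List.ofFn s).foldr (fun i g => MvPolynomial.pderiv i g) f)) *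
      ∏ a : Fin j, MvPolynomial.X (s a)

/-- `q` is an inflection point of the plane curve `{g = 0} ⊆ ℙ²(K)`: some line `L'` through `q`
meets the curve with multiplicity at least `3` at `q`, or is contained in the curve. -/
def IsInflectionPointAt {K : Type*} [Field K]
    (g : MvPolynomial (Fin 3) K) (q : Fin 3 → K) : Prop :=
  ∃ w : Fin 3 → K, LinearIndependent K ![q, w] ∧
    (ordGE g q w 3 ∨ ∀ s t : K, MvPolynomial.eval (s • q + t • w) g = 0)

/-- The defining condition for a line `L` (given by the subspace `W`) to be of the second kind:
for every plane `Π = span{a,b,c} ⊇ L = span{a,b}` with residual curve `Γ_Π = {g = 0}`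
(where `f|_Π = z · g` in the coordinates `(x,y,z)` on `Π`), every point of `L ∩ Γ_Π`
is an inflection point of `Γ_Π`. -/
def SecondKindCond {K : Type*} [Field K]
    (f : MvPolynomial (Fin 4) K) (d : ℕ) (W : Submodule K (Fin 4 → K)) : Prop :=
  ∀ a b c : Fin 4 → K, a ∈ W → b ∈ W → LinearIndependent K ![a, b, c] →
    ∀ g : MvPolynomial (Fin 3) K, g.IsHomogeneous (d - 1) →
      (∀ x y z : K,
          MvPolynomial.eval (x • a + y • b + z • c) f = z * MvPolynomial.eval ![x, y, z] g) →
      ∀ s t : K, (s ≠ 0 ∨ t ≠ 0) → MvPolynomial.eval ![s, t, 0] g = 0 →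
        IsInflectionPointAt g ![s, t, 0]

/-- A line of the second kind on the surface `{f = 0}`. -/
def IsLineOfSecondKind {K : Type*} [Field K]
    (f : MvPolynomial (Fin 4) K) (d : ℕ) (W : Submodule K (Fin 4 → K)) : Prop :=
  IsLineInSurface f W ∧ SecondKindCond f d W

/-- A line of the first kind on the surface `{f = 0}`. -/
def IsLineOfFirstKind {K : Type*} [Field K]
    (f : MvPolynomial (Fin 4) K) (d : ℕ) (W : Submodule K (Fin 4 → K)) : Prop :=
  IsLineInSurface f W ∧ ¬ SecondKindCond f d W

/-- The directional derivative of polynomials along the constant vector field `v`. -/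
noncomputable def dirDeriv {K : Type*} [CommSemiring K] {n : ℕ} (v : Fin n → K) :
    Derivation K (MvPolynomial (Fin n) K) (MvPolynomial (Fin n) K) :=
  mkDerivation K (fun i => C (v i))

section Restriction

variable {K : Type*} [CommSemiring K] {n : ℕ}

theorem dirDeriv_eq_sum (v : Fin n → K) (g : MvPolynomial (Fin n) K) :
    dirDeriv v g = ∑ i, C (v i) * pderiv i g := by
  induction g using MvPolynomial.induction_on with
  | C a => simp [dirDeriv]
  | add p q hp hq => simp only [map_add, hp, hq, mul_add, Finset.sum_add_distrib]
  | mul_X p i hp =>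
    simp only [Derivation.leibniz, hp, smul_eq_mul, mul_add, Finset.sum_add_distrib, pderiv_X,
      Finset.mul_sum]
    simp [dirDeriv, Pi.single_apply, mul_comm, mul_left_comm]

theorem eval_dirDeriv (v p : Fin n → K) (g : MvPolynomial (Fin n) K) :
    eval p (dirDeriv v g) = ∑ i, v i * eval p (pderiv i g) := by
  simp [dirDeriv_eq_sum]

theorem derivative_restrictLine (g : MvPolynomial (Fin n) K) (u v : Fin n → K) :
    Polynomial.derivative (restrictLine g u v) = restrictLine (dirDeriv v g) u v := by
  unfold restrictLine
  induction g using MvPolynomial.induction_on with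
  | C a => simp [dirDeriv]
  | add p q hp hq => simp only [map_add, hp, hq]
  | mul_X p i hp =>
    simp only [map_mul, Polynomial.derivative_mul, hp, Derivation.leibniz, map_add, smul_eq_mul,
      aeval_X]
    simp [dirDeriv, Polynomial.algebraMap_eq]
    ring

theorem coeff_zero_restrictLine (g : MvPolynomial (Fin n) K) (u v : Fin n → K) :
    (restrictLine g u v).coeff 0 = eval u g := by
  unfold restrictLine
  induction g using MvPolynomial.induction_on with
  | C a => simp [Polynomial.algebraMap_eq]
  | add p q hp hq => simp only [map_add, Polynomial.coeff_add, hp, hq]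
  | mul_X p i hp => simp only [map_mul, Polynomial.mul_coeff_zero, hp]; simp

theorem factorial_mul_coeff_restrictLine (g : MvPolynomial (Fin n) K) (u v : Fin n → K) (j : ℕ) :
    (j.factorial : K) * (restrictLine g u v).coeff j = eval u ((dirDeriv v)^[j] g) := by
  have h : Polynomial.derivative^[j] (restrictLine g u v) =
      restrictLine ((dirDeriv v)^[j] g) u v := by
    induction j with
    | zero => rfl
    | succ j ih =>
      rw [Function.iterate_succ_apply', Function.iterate_succ_apply', ih, derivative_restrictLine]
  rw [← coeff_zero_restrictLine _ u v, ← h, Polynomial.coeff_iterate_derivative]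
  simp [Nat.descFactorial_self]

theorem coeff_one_restrictLine (g : MvPolynomial (Fin n) K) (u v : Fin n → K) :
    (restrictLine g u v).coeff 1 = eval u (dirDeriv v g) := by
  simpa using factorial_mul_coeff_restrictLine g u v 1

theorem iterate_dirDeriv (v : Fin n → K) (g : MvPolynomial (Fin n) K) (j : ℕ) :
    (dirDeriv v)^[j] g = ∑ s : Fin j → Fin n,
      C (∏ a, v (s a)) * (List.ofFn s).foldr (fun i g => pderiv i g) g := by
  induction j with
  | zero => simp
  | succ j ih =>
    rw [Function.iterate_succ_apply', ih, dirDeriv_eq_sum,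
      ← (Fin.consEquiv fun _ => Fin n).sum_comp, Fintype.sum_prod_type]
    refine Finset.sum_congr rfl fun i _ => ?_
    simp only [map_sum, Finset.mul_sum]
    refine Finset.sum_congr rfl fun s _ => ?_
    rw [pderiv_C_mul]
    simp [Fin.consEquiv, Fin.prod_univ_succ, List.ofFn_succ, mul_assoc]

theorem eval_tForm (f : MvPolynomial (Fin 4) K) (j : ℕ) (u z : Fin 4 → K) :
    eval z (tForm f j u) = (j.factorial : K) * (restrictLine f u z).coeff j := by
  rw [factorial_mul_coeff_restrictLine, iterate_dirDeriv]
  simp [tForm, map_sum, map_prod, mul_comm]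

theorem eval_restrictLine (g : MvPolynomial (Fin n) K) (u v : Fin n → K) (ε : K) :
    (restrictLine g u v).eval ε = eval (u + ε • v) g := by
  unfold restrictLine
  induction g using MvPolynomial.induction_on with
  | C a => simp [Polynomial.algebraMap_eq]
  | add p q hp hq => simp only [map_add, Polynomial.eval_add, hp, hq]
  | mul_X p i hp => simp only [map_mul, Polynomial.eval_mul, hp]; simp [mul_comm ε]

end Restriction

theorem restrictLine_eq_zero {K : Type*} [Field K] [Infinite K] {n : ℕ}
    {g : MvPolynomial (Fin n) K} {u v : Fin n → K} (h : ∀ ε : K, eval (u + ε • v) g = 0) :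
    restrictLine g u v = 0 :=
  Polynomial.funext fun ε => by simp [eval_restrictLine, h]

/-- The pullback of `f` to the plane spanned by `a`, `b`, `c`. -/
noncomputable def restrictPlane {K : Type*} [CommSemiring K] {n : ℕ}
    (f : MvPolynomial (Fin n) K) (a b c : Fin n → K) : MvPolynomial (Fin 3) K :=
  aeval (fun i => X 0 * C (a i) + X 1 * C (b i) + X 2 * C (c i)) f

section Plane

variable {K : Type*} [Field K] {n : ℕ}

theorem eval_restrictPlane (f : MvPolynomial (Fin n) K) (a b c : Fin n → K) (p : Fin 3 → K) :
    eval p (restrictPlane f a b c) = eval (p 0 • a + p 1 • b + p 2 • c) f := by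
  unfold restrictPlane
  induction f using MvPolynomial.induction_on with
  | C a => simp [MvPolynomial.algebraMap_eq]
  | add p q hp hq => simp only [map_add, hp, hq]
  | mul_X p i hp => simp only [map_mul, hp]; simp

theorem isHomogeneous_restrictPlane {f : MvPolynomial (Fin n) K} {d : ℕ} (hf : f.IsHomogeneous d)
    (a b c : Fin n → K) : (restrictPlane f a b c).IsHomogeneous d := by
  have h (i : Fin 3) (r : K) : (X i * C r : MvPolynomial (Fin 3) K).IsHomogeneous 1 :=
    (isHomogeneous_X K i).mul (isHomogeneous_C _ r)
  simpa only [one_mul, restrictPlane] using hf.aeval (fun i => X 0 * C (a i) + X 1 * C (b i) + X 2 * C (c i))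
    fun i => ((h 0 _).add (h 1 _)).add (h 2 _)

theorem X_dvd_of_eval_eq_zero [Infinite K] {σ : Type*} [DecidableEq σ] {F : MvPolynomial σ K}
    (j : σ) (h : ∀ p : σ → K, p j = 0 → eval p F = 0) : X j ∣ F := by
  have h₀ : aeval (fun i => if i = j then (0 : MvPolynomial σ K) else X i) F = 0 := by
    refine MvPolynomial.funext fun p => ?_
    rw [map_zero, ← h (fun i => if i = j then 0 else p i) (by simp), aeval_def, eval,
      MvPolynomial.hom_eval₂]
    simp only [eval₂Hom]
    congr 1
    · ext; simp
    · ext i; split_ifs <;> simp_all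
  rw [← Ideal.mem_span_singleton, ← Ideal.Quotient.eq_zero_iff_mem, ← map_zero (Ideal.Quotient.mk _),
    ← h₀, ← Ideal.Quotient.mkₐ_eq_mk K]
  conv_lhs => rw [← aeval_X_left_apply F]
  rw [MvPolynomial.comp_aeval_apply, MvPolynomial.comp_aeval_apply]
  congr 2
  ext i
  split_ifs with hi
  · subst hi
    simp
  · rfl

theorem isHomogeneous_of_X_mul {σ : Type*} {j : σ} {g : MvPolynomial σ K} {d : ℕ}
    (h : (X j * g).IsHomogeneous d) : g.IsHomogeneous (d - 1) := by
  intro m hm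
  have := @h (Finsupp.single j 1 + m) (by rwa [add_comm, mul_comm, coeff_mul_X])
  rw [map_add, Finsupp.weight_single] at this
  simp at this
  omega

end Plane

theorem eval_pderiv_of_single {K : Type*} [CommSemiring K] {n m : ℕ} {i : Fin n}
    {g : MvPolynomial (Fin n) K} (hg : g.IsHomogeneous m) :
    eval (Pi.single i 1) (pderiv i g) = m * eval (Pi.single i 1) g := by
  have h := congrArg (eval (Pi.single i 1)) hg.sum_X_mul_pderiv
  simpa [Pi.single_apply] using h

theorem pderiv_comm {K σ : Type*} [CommRing K] (i j : σ) (g : MvPolynomial σ K) :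
    pderiv i (pderiv j g) = pderiv j (pderiv i g) := by
  have h : ⁅pderiv (R := K) i, pderiv (R := K) j⁆ = 0 := derivation_ext fun k => by
    classical
    rw [Derivation.commutator_apply, pderiv_X, pderiv_X]
    simp [Pi.single_apply, apply_ite]
  have := DFunLike.congr_fun h g
  rwa [Derivation.commutator_apply, Derivation.zero_apply, sub_eq_zero] at this

theorem eval_dirDeriv_dirDeriv {K : Type*} [CommSemiring K] {n : ℕ} (v p : Fin n → K)
    (g : MvPolynomial (Fin n) K) :
    eval p (dirDeriv v (dirDeriv v g)) =
      ∑ j, ∑ i, v i * v j * eval p (pderiv i (pderiv j g)) := by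
  simp only [eval_dirDeriv, dirDeriv_eq_sum v g, map_sum, pderiv_C_mul]
  simp [mul_assoc]

/-- If a plane curve passes through `![1, 0, 0]` tangentially to the direction `![0, 0, 1]`,
then the second derivative in any direction in the plane `y = 0` is determined by that in the
direction `![0, 0, 1]`. -/
theorem eval_dirDeriv_dirDeriv_of_isHomogeneous {K : Type*} [CommRing K] {m : ℕ}
    {g : MvPolynomial (Fin 3) K} (hg : g.IsHomogeneous m) (h0 : eval ![1, 0, 0] g = 0)
    (h2 : eval ![1, 0, 0] (pderiv 2 g) = 0) {w : Fin 3 → K} (hw : w 1 = 0) :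
    eval ![1, 0, 0] (dirDeriv w (dirDeriv w g)) =
      w 2 ^ 2 * eval ![1, 0, 0] (pderiv 2 (pderiv 2 g)) := by
  have he : (Pi.single 0 1 : Fin 3 → K) = ![1, 0, 0] := by
    ext i; fin_cases i <;> simp
  have euler {k : ℕ} {h : MvPolynomial (Fin 3) K} (hh : h.IsHomogeneous k) :
      eval ![1, 0, 0] (pderiv 0 h) = k * eval ![1, 0, 0] h := by
    rw [← he, eval_pderiv_of_single hh]
  have h00 : eval ![1, 0, 0] (pderiv 0 (pderiv 0 g)) = 0 := by
    rw [euler hg.pderiv, euler hg, h0, mul_zero, mul_zero]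
  have h02 : eval ![1, 0, 0] (pderiv 0 (pderiv 2 g)) = 0 := by
    rw [euler hg.pderiv, h2, mul_zero]
  have h20 : eval ![1, 0, 0] (pderiv 2 (pderiv 0 g)) = 0 := by
    rw [pderiv_comm, h02]
  rw [eval_dirDeriv_dirDeriv]
  simp [Fin.sum_univ_three, hw, h00, h02, h20, sq]

theorem restrictLine_restrictPlane {K : Type*} [Field K] {n : ℕ} (f : MvPolynomial (Fin n) K)
    (a b c : Fin n → K) (p q : Fin 3 → K) :
    restrictLine (restrictPlane f a b c) p q =
      restrictLine f (p 0 • a + p 1 • b + p 2 • c) (q 0 • a + q 1 • b + q 2 • c) := by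
  unfold restrictLine restrictPlane
  rw [MvPolynomial.comp_aeval_apply]
  congr 2
  ext1 i
  simp [Polynomial.algebraMap_eq]
  ring

theorem exists_linearIndependent_of_notMem {K V : Type*} [Field K] [AddCommGroup V] [Module K V]
    {W : Submodule K V} (hW : Module.finrank K W = 2) {u z : V} (hu : u ≠ 0) (huW : u ∈ W)
    (hz : z ∉ W) : ∃ b ∈ W, LinearIndependent K ![u, b, z] := by
  obtain ⟨b, hbW, hb⟩ : ∃ b ∈ W, b ∉ Submodule.span K {u} := by
    by_contra! h
    have := Submodule.finrank_mono (show W ≤ Submodule.span K {u} from h)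
    rw [hW, finrank_span_singleton hu] at this
    omega
  refine ⟨b, hbW, ?_⟩
  rw [Fintype.linearIndependent_iff]
  intro r hr
  simp only [Fin.sum_univ_three, Matrix.cons_val_zero, Matrix.cons_val_one,
    Matrix.cons_val_two, Matrix.head_cons, Matrix.tail_cons] at hr
  have h2 : r 2 = 0 := by
    by_contra h
    refine hz ((W.smul_mem_iff h).1 ?_)
    rw [eq_neg_of_add_eq_zero_right hr]
    exact W.neg_mem (W.add_mem (W.smul_mem _ huW) (W.smul_mem _ hbW))
  rw [h2, zero_smul, add_zero] at hr
  have h1 : r 1 = 0 := by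
    by_contra h
    refine hb (((Submodule.span K {u}).smul_mem_iff h).1 ?_)
    rw [eq_neg_of_add_eq_zero_right hr]
    exact Submodule.neg_mem _ (Submodule.smul_mem _ _ (Submodule.mem_span_singleton_self u))
  rw [h1, zero_smul, add_zero, smul_eq_zero_iff_left hu] at hr
  intro i
  fin_cases i <;> assumption

theorem exists_eq_of_linearIndependent_of_apply_eq_zero {K : Type*} [Field K]
    {φ : Module.Dual K (Fin 4 → K)} (hφ : φ ≠ 0) {a b c : Fin 4 → K}
    (hli : LinearIndependent K ![a, b, c]) (ha : φ a = 0) (hb : φ b = 0) (hc : φ c = 0)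
    {v : Fin 4 → K} (hv : φ v = 0) : ∃ p : Fin 3 → K, v = p 0 • a + p 1 • b + p 2 • c := by
  have hle : Submodule.span K (Set.range ![a, b, c]) ≤ LinearMap.ker φ := by
    rw [Submodule.span_le]
    rintro _ ⟨i, rfl⟩
    fin_cases i <;> simpa
  have hker := Module.Dual.finrank_ker_add_one_of_ne_zero hφ
  have heq := Submodule.eq_of_le_of_finrank_eq hle (by
    rw [finrank_span_eq_card hli]; simp at hker ⊢; omega)
  have : v ∈ Submodule.span K (Set.range ![a, b, c]) := heq ▸ hv
  obtain ⟨p, rfl⟩ := (Submodule.mem_span_range_iff_exists_fun K).1 this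
  exact ⟨p, by simp [Fin.sum_univ_three]⟩

theorem natCast_ne_zero_of_ringChar {K : Type*} [Field K] {d k : ℕ}
    (hchar : ringChar K = 0 ∨ d < ringChar K) (hk : k ≠ 0) (hkd : k ≤ d) : (k : K) ≠ 0 := by
  rw [Ne, ringChar.spec]
  intro h
  rcases hchar with h0 | h0
  · rw [h0, zero_dvd_iff] at h
    exact hk h
  · exact absurd (Nat.le_of_dvd (Nat.pos_of_ne_zero hk) h) (by omega)

/-- The residual curve of a plane section containing the line `z = 0`. -/
theorem exists_residual {K : Type*} [Field K] [Infinite K] {n d : ℕ}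
    {f : MvPolynomial (Fin n) K} (hf : f.IsHomogeneous d) {W : Submodule K (Fin n → K)}
    (hW : ∀ v ∈ W, eval v f = 0) {a b : Fin n → K} (ha : a ∈ W) (hb : b ∈ W) (c : Fin n → K) :
    ∃ g : MvPolynomial (Fin 3) K, g.IsHomogeneous (d - 1) ∧ restrictPlane f a b c = X 2 * g := by
  obtain ⟨g, hg⟩ : X 2 ∣ restrictPlane f a b c := by
    refine X_dvd_of_eval_eq_zero 2 fun p hp => ?_
    rw [eval_restrictPlane, hp, zero_smul, add_zero]
    exact hW _ (W.add_mem (W.smul_mem _ ha) (W.smul_mem _ hb))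
  exact ⟨g, isHomogeneous_of_X_mul (hg ▸ isHomogeneous_restrictPlane hf a b c), hg⟩

theorem coeff_succ_restrictLine_of_residual {K : Type*} [Field K] {n : ℕ}
    {f : MvPolynomial (Fin n) K} {a b c : Fin n → K} {g : MvPolynomial (Fin 3) K}
    (hg : restrictPlane f a b c = X 2 * g) (q : Fin 3 → K) (k : ℕ) :
    (restrictLine f a (q 0 • a + q 1 • b + q 2 • c)).coeff (k + 1) =
      q 2 * (restrictLine g ![1, 0, 0] q).coeff k := by
  have h := restrictLine_restrictPlane f a b c ![1, 0, 0] q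
  rw [hg] at h
  simp only [Matrix.cons_val_zero, Matrix.cons_val_one, Matrix.cons_val, one_smul, zero_smul,
    add_zero] at h
  rw [← h]
  simp only [restrictLine, map_mul, aeval_X, Matrix.cons_val, map_zero, zero_add]
  rw [mul_assoc, Polynomial.coeff_X_mul, Polynomial.coeff_C_mul]

theorem IsInflectionPointAt.exists_ordGE {K : Type*} [Field K] [Infinite K]
    {g : MvPolynomial (Fin 3) K} {q : Fin 3 → K} (h : IsInflectionPointAt g q) :
    ∃ w : Fin 3 → K, LinearIndependent K ![q, w] ∧ ordGE g q w 3 := by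
  obtain ⟨w, hli, hw | hw⟩ := h
  · exact ⟨w, hli, hw⟩
  · refine ⟨w, hli, fun j _ => ?_⟩
    rw [restrictLine_eq_zero fun ε => by simpa using hw 1 ε, Polynomial.coeff_zero]

theorem second_kind_t3_vanishes
    {K : Type*} [Field K] [IsAlgClosed K] (d : ℕ) (hd : 3 ≤ d)
    (hchar : ringChar K = 0 ∨ d < ringChar K)
    (f : MvPolynomial (Fin 4) K) (hf : IsSmoothSurfaceOfDegree f d)
    (W : Submodule K (Fin 4 → K)) (hW : IsLineOfSecondKind f d W)
    (u : Fin 4 → K) (hu : u ≠ 0) (huW : u ∈ W)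
    (hV : ¬ ∀ z : Fin 4 → K,
        MvPolynomial.eval z (tForm f 1 u) = 0 → MvPolynomial.eval z (tForm f 2 u) = 0) :
    ∀ z : Fin 4 → K, MvPolynomial.eval z (tForm f 1 u) = 0 →
      MvPolynomial.eval z (tForm f 2 u) = 0 → MvPolynomial.eval z (tForm f 3 u) = 0 := by
  have : Infinite K := IsAlgClosed.instInfinite
  have two_ne : (2 : K) ≠ 0 := by
    exact_mod_cast natCast_ne_zero_of_ringChar hchar two_ne_zero (by omega : 2 ≤ d)
  obtain ⟨⟨hrank, hfW⟩, hsecond⟩ := hW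
  have hline {v : Fin 4 → K} (hv : v ∈ W) : restrictLine f u v = 0 :=
    restrictLine_eq_zero fun ε => hfW _ (W.add_mem huW (W.smul_mem _ hv))
  intro z hz1 hz2
  rw [eval_tForm] at hz1 hz2 ⊢
  simp only [Nat.factorial, Nat.cast_one, one_mul, mul_one] at hz1
  replace hz2 := (mul_eq_zero.1 hz2).resolve_left (by simpa [Nat.factorial] using two_ne)
  suffices (restrictLine f u z).coeff 3 = 0 by rw [this, mul_zero]
  by_cases hzW : z ∈ W
  · simp [hline hzW]
  obtain ⟨b, hbW, hli⟩ := exists_linearIndependent_of_notMem hrank hu huW hzW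
  obtain ⟨g, hghom, hg⟩ := exists_residual hf.1 hfW huW hbW z
  have hcoeff := coeff_succ_restrictLine_of_residual hg
  have hcoeffz (k : ℕ) : (restrictLine f u z).coeff (k + 1) =
      (restrictLine g ![1, 0, 0] ![0, 0, 1]).coeff k := by
    simpa using hcoeff ![0, 0, 1] k
  have hg0 : eval ![1, 0, 0] g = 0 := by
    rw [← coeff_zero_restrictLine g _ ![0, 0, 1], ← hcoeffz, hz1]
  have hg2 : eval ![1, 0, 0] (pderiv 2 g) = 0 := by
    have := hcoeffz 1
    rw [hz2, coeff_one_restrictLine, eval_dirDeriv] at this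
    simpa [Fin.sum_univ_three] using this.symm
  have hgX : eval ![1, 0, 0] (pderiv 0 g) = 0 := by
    have he : (Pi.single 0 1 : Fin 3 → K) = ![1, 0, 0] := by
      ext i; fin_cases i <;> simp
    rw [← he, eval_pderiv_of_single hghom, he, hg0, mul_zero]
  have hinfl : IsInflectionPointAt g ![1, 0, 0] :=
    hsecond u b z huW hbW hli g hghom
      (fun x y t => by simpa [hg] using (eval_restrictPlane f u b z ![x, y, t]).symm)
      1 0 (Or.inl one_ne_zero) hg0
  obtain ⟨w, hwli, hw⟩ := hinfl.exists_ordGE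
  have hw1 : w 1 = 0 := by
    by_contra hw1
    have hg1 : eval ![1, 0, 0] (pderiv 1 g) = 0 := by
      have := hw 1 (by norm_num)
      rw [coeff_one_restrictLine, eval_dirDeriv] at this
      simpa [Fin.sum_univ_three, hgX, hg2, hw1] using this
    refine hV fun v hv => ?_
    rw [eval_tForm] at hv ⊢
    simp only [Nat.factorial, Nat.cast_one, one_mul, mul_one] at hv
    let φ : Module.Dual K (Fin 4 → K) := ∑ i, eval u (pderiv i f) • LinearMap.proj i
    have hφ (v : Fin 4 → K) : φ v = (restrictLine f u v).coeff 1 := by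
      simp [φ, coeff_one_restrictLine, eval_dirDeriv, LinearMap.sum_apply, mul_comm]
    have hφ0 : φ ≠ 0 := by
      obtain ⟨i, hi⟩ := hf.2 u hu
      intro h
      apply hi
      simpa [φ, LinearMap.sum_apply, Pi.single_apply] using LinearMap.congr_fun h (Pi.single i 1)
    obtain ⟨p, rfl⟩ := exists_eq_of_linearIndependent_of_apply_eq_zero hφ0 hli
      (by rw [hφ, hline huW, Polynomial.coeff_zero])
      (by rw [hφ, hline hbW, Polynomial.coeff_zero]) ((hφ z).trans hz1) ((hφ v).trans hv)
    rw [hcoeff, coeff_one_restrictLine, eval_dirDeriv]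
    simp [Fin.sum_univ_three, hgX, hg1, hg2]
  have hw2 : w 2 ≠ 0 := by
    intro hw2
    rw [LinearIndependent.pair_iff] at hwli
    have := hwli (-w 0) 1 (by ext i; fin_cases i <;> simp [hw1, hw2])
    exact one_ne_zero this.2
  have key (q : Fin 3 → K) (hq : q 1 = 0) :
      2 * (restrictLine g ![1, 0, 0] q).coeff 2 =
        q 2 ^ 2 * eval ![1, 0, 0] (pderiv 2 (pderiv 2 g)) := by
    rw [← eval_dirDeriv_dirDeriv_of_isHomogeneous hghom hg0 hg2 hq]
    simpa [Nat.factorial] using factorial_mul_coeff_restrictLine g ![1, 0, 0] q 2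
  have h22 : eval ![1, 0, 0] (pderiv 2 (pderiv 2 g)) = 0 := by
    have := key w hw1
    rw [hw 2 (by norm_num), mul_zero] at this
    exact (mul_eq_zero.1 this.symm).resolve_left (pow_ne_zero _ hw2)
  rw [hcoeffz]
  have := key ![0, 0, 1] (by simp)
  rw [h22, mul_zero] at this
  exact (mul_eq_zero.1 this).resolve_left two_ne
end

section
/- The Schur quartic X ⊂ P³(ℂ), defined by the equation x₀⁴ − x₀x₁³ = x₂⁴ − x₂x₃³, is a smooth surface containing exactly 64 lines. -/
open MvPolynomial

/-- The binary quartic form `φ(x, y) = x⁴ - x y³`; the Schur quartic is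
`φ(x₀, x₁) = φ(x₂, x₃)`. -/
def schurForm (x y : ℂ) : ℂ := x ^ 4 - x * y ^ 3

lemma eval_schur (w : Fin 4 → ℂ) :
    eval w (X 0 ^ 4 - X 0 * X 1 ^ 3 - X 2 ^ 4 + X 2 * X 3 ^ 3 : MvPolynomial (Fin 4) ℂ) =
      schurForm (w 0) (w 1) - schurForm (w 2) (w 3) := by
  simp [schurForm]; ring

lemma isSmoothSurfaceOfDegree_schur :
    IsSmoothSurfaceOfDegree
      (X 0 ^ 4 - X 0 * X 1 ^ 3 - X 2 ^ 4 + X 2 * X 3 ^ 3 : MvPolynomial (Fin 4) ℂ) 4 := by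
  refine ⟨?_, fun w hw ↦ ?_⟩
  · have hX (i : Fin 4) : (X i ^ 4 : MvPolynomial (Fin 4) ℂ).IsHomogeneous 4 := by
      simpa using (isHomogeneous_X ℂ i).pow 4
    have hXY (i j : Fin 4) : (X i * X j ^ 3 : MvPolynomial (Fin 4) ℂ).IsHomogeneous 4 := by
      simpa using (isHomogeneous_X ℂ i).mul ((isHomogeneous_X ℂ j).pow 3)
    exact (((hX 0).sub (hXY 0 1)).sub (hX 2)).add (hXY 2 3)
  · by_contra! h
    have h0 := h 0
    have h1 := h 1
    have h2 := h 2
    have h3 := h 3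
    simp [pderiv_X, Derivation.leibniz_pow] at h0 h1 h2 h3
    refine hw (funext fun i ↦ ?_)
    fin_cases i <;> simp <;> grind

/-- The `n`-th roots of `c`. -/
abbrev PowRoot (n : ℕ) (c : ℂ) : Type := {z : ℂ // z ^ n = c}

lemma PowRoot.card {n : ℕ} (hn : n ≠ 0) {c : ℂ} (hc : c ≠ 0) : Nat.card (PowRoot n c) = n := by
  have hζ := Complex.isPrimitiveRoot_exp n hn
  obtain ⟨α, hα⟩ := IsAlgClosed.exists_pow_nat_eq c (Nat.pos_of_ne_zero hn)
  have hset : {z : ℂ | z ^ n = c} = ((Polynomial.nthRoots n c).toFinset : Set ℂ) := by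
    ext z
    simp [Polynomial.mem_nthRoots (Nat.pos_of_ne_zero hn)]
  change Nat.card ({z : ℂ | z ^ n = c} : Set ℂ) = n
  rw [Nat.card_coe_set_eq, hset, Set.ncard_coe_finset,
    Multiset.toFinset_card_of_nodup (hζ.nthRoots_nodup hc), hζ.card_nthRoots, if_pos ⟨α, hα⟩]

/-- Index type for the zeros of `schurForm` in `ℙ¹`. -/
abbrev SchurZero : Type := Option (PowRoot 3 1)

/-- First coordinate of the normalized representative of a zero of `schurForm`. -/
def SchurZero.fst : SchurZero → ℂ
  | none => 0
  | some _ => 1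

/-- Second coordinate of the normalized representative of a zero of `schurForm`. -/
def SchurZero.snd : SchurZero → ℂ
  | none => 1
  | some ζ => ζ.1

lemma SchurZero.schurForm_eq_zero (z : SchurZero) : schurForm z.fst z.snd = 0 := by
  rcases z with _ | ⟨ζ, hζ⟩ <;> simp [fst, snd, schurForm]
  rw [hζ]; ring

lemma SchurZero.ne_zero (z : SchurZero) : z.fst ≠ 0 ∨ z.snd ≠ 0 := by
  rcases z with _ | ζ <;> simp [fst, snd]

lemma SchurZero.eq_of_smul {z z' : SchurZero} {k : ℂ} (h₁ : k * z'.fst = z.fst)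
    (h₂ : k * z'.snd = z.snd) : z = z' := by
  rcases z with _ | ⟨ζ, hζ⟩ <;> rcases z' with _ | ⟨ζ', hζ'⟩ <;> simp_all [fst, snd]

lemma SchurZero.exists_of_schurForm_eq_zero {x y : ℂ} (hxy : x ≠ 0 ∨ y ≠ 0)
    (h : schurForm x y = 0) : ∃ z : SchurZero, ∃ k : ℂ, k ≠ 0 ∧ x = k * z.fst ∧ y = k * z.snd := by
  unfold schurForm at h
  by_cases hx : x = 0
  · exact ⟨none, y, by simpa [hx] using hxy, by simp [fst, hx], by simp [snd]⟩
  · have h3 : y ^ 3 = x ^ 3 := mul_left_cancel₀ hx (by linear_combination -h)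
    refine ⟨some ⟨y / x, ?_⟩, x, hx, by simp [fst], ?_⟩
    · rw [div_pow, h3, div_self (pow_ne_zero 3 hx)]
    · simp [snd]; field_simp

/-- A pair of linear forms `(a x + b y, c x + d y)`, recorded as `(a, b, c, d)`, preserves
`schurForm`. -/
def PreservesSchurForm (A : ℂ × ℂ × ℂ × ℂ) : Prop :=
  ∀ x y, schurForm (A.1 * x + A.2.1 * y) (A.2.2.1 * x + A.2.2.2 * y) = schurForm x y

/-- Index type for the linear substitutions preserving `schurForm`. -/
abbrev SchurAut : Type :=
  (PowRoot 4 1 × PowRoot 3 1) ⊕ (PowRoot 4 (1 / 9) × PowRoot 3 1 × PowRoot 3 1)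

/-- The coefficients of the linear substitution with a given index. -/
def SchurAut.coeffs : SchurAut → ℂ × ℂ × ℂ × ℂ
  | .inl (a, ζ) => (a, 0, 0, a * ζ)
  | .inr (a, η, ζ) => (a, -(η * a), -2 * ζ * a, -(ζ * η * a))

lemma PowRoot.ne_zero {n : ℕ} (hn : n ≠ 0) {c : ℂ} (hc : c ≠ 0) (z : PowRoot n c) : z.1 ≠ 0 := by
  intro h
  have := z.2
  rw [h, zero_pow hn] at this
  exact hc this.symm

lemma SchurAut.coeffs_injective : Function.Injective SchurAut.coeffs := by
  have hne₁ (a : PowRoot 4 1) : a.1 ≠ 0 := a.ne_zero (by norm_num) (by norm_num)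
  have hne₂ (a : PowRoot 4 (1 / 9)) : a.1 ≠ 0 := a.ne_zero (by norm_num) (by norm_num)
  have hne₃ (a : PowRoot 3 1) : a.1 ≠ 0 := a.ne_zero (by norm_num) (by norm_num)
  rintro (⟨a, ζ⟩ | ⟨a, η, ζ⟩) (⟨a', ζ'⟩ | ⟨a', η', ζ'⟩) h <;>
    simp only [coeffs, Prod.mk.injEq] at h <;> obtain ⟨h₁, h₂, h₃, h₄⟩ := h
  · rw [h₁] at h₄
    rw [Subtype.ext h₁, Subtype.ext (mul_left_cancel₀ (hne₁ a') h₄)]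
  · simp [hne₂ a', hne₃ η'] at h₂
  · simp [hne₂ a, hne₃ η] at h₂
  · rw [h₁] at h₂ h₃
    have hη : η.1 = η'.1 := mul_right_cancel₀ (hne₂ a') (by linear_combination -h₂)
    have hζ : ζ.1 = ζ'.1 := mul_right_cancel₀ (hne₂ a') (by linear_combination -h₃ / 2)
    rw [Subtype.ext h₁, Subtype.ext hη, Subtype.ext hζ]

lemma SchurAut.preservesSchurForm (s : SchurAut) : PreservesSchurForm s.coeffs := by
  intro x y
  rcases s with ⟨⟨a, ha⟩, ⟨ζ, hζ⟩⟩ | ⟨⟨a, ha⟩, ⟨η, hη⟩, ⟨ζ, hζ⟩⟩ <;> simp only [coeffs, schurForm]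
  · linear_combination (x ^ 4 - x * y ^ 3 * ζ ^ 3) * ha - x * y ^ 3 * hζ
  · linear_combination
      (a ^ 4 * (x - η * y) * (2 * x + η * y) ^ 3) * hζ + (a ^ 4 * (-9 * x * y ^ 3)) * hη +
      (9 * x ^ 4 - 9 * x * y ^ 3) * ha

lemma SchurAut.exists_coeffs_eq {A : ℂ × ℂ × ℂ × ℂ} (hA : PreservesSchurForm A) :
    ∃ s : SchurAut, s.coeffs = A := by
  obtain ⟨a, b, c, d⟩ := A
  simp only [PreservesSchurForm, schurForm] at hA
  have e₀ := hA 1 0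
  have e₄ := hA 0 1
  have ep := hA 1 1
  have em := hA 1 (-1)
  have e₂ := hA 1 2
  have h₀ : a ^ 4 - a * c ^ 3 = 1 := by linear_combination e₀
  have h₁ : 4 * a ^ 3 * b - b * c ^ 3 - 3 * a * c ^ 2 * d = 0 := by
    linear_combination (ep - em) / 2 - (e₂ + 3 * e₀ - 12 * e₄ - 3 * ep - em) / 6
  have h₂ : 2 * a ^ 2 * b ^ 2 = c * d * (b * c + a * d) := by
    linear_combination ((ep + em) / 2 - e₀ - e₄) / 3
  have h₃ : 4 * a * b ^ 3 - 3 * b * c * d ^ 2 - a * d ^ 3 = -1 := by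
    linear_combination (e₂ + 3 * e₀ - 12 * e₄ - 3 * ep - em) / 6
  have h₄ : b ^ 4 - b * d ^ 3 = 0 := by linear_combination e₄
  have ha : a ≠ 0 := by rintro rfl; simp at h₀
  by_cases hb : b = 0
  · subst hb
    have hd : d ≠ 0 := by rintro rfl; simp at h₃
    have hc : c = 0 := by simpa [ha, hd] using h₁
    subst hc
    have ha4 : a ^ 4 = 1 := by linear_combination h₀
    refine ⟨.inl (⟨a, ha4⟩, ⟨d / a, ?_⟩), ?_⟩
    · rw [div_pow, div_eq_one_iff_eq (pow_ne_zero 3 ha)]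
      exact mul_left_cancel₀ ha (by linear_combination -h₃ - ha4)
    · simp [coeffs, mul_div_cancel₀ _ ha]
  · have hd3 : d ^ 3 = b ^ 3 := mul_left_cancel₀ hb (by linear_combination -h₄)
    obtain ⟨ζ, hd⟩ : ∃ ζ, d = ζ * b := ⟨d / b, by field_simp⟩
    subst hd
    have hζ : ζ ^ 3 = 1 := mul_right_cancel₀ (pow_ne_zero 3 hb) (by linear_combination hd3)
    have hζ0 : ζ ≠ 0 := by rintro rfl; simp at hζ
    have hne : a - ζ ^ 2 * c ≠ 0 := by
      intro h
      have : (0 : ℂ) = -1 := by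
        linear_combination h₃ - 3 * b ^ 3 * h + a * b ^ 3 * hζ
      norm_num at this
    have hfac : (a - ζ ^ 2 * c) * (2 * a + ζ ^ 2 * c) = 0 := by
      refine mul_left_cancel₀ (pow_ne_zero 2 hb) ?_
      linear_combination h₂ - b ^ 2 * ζ * c ^ 2 * hζ
    have hc' : ζ ^ 2 * c = -2 * a := by
      linear_combination (mul_eq_zero.mp hfac).resolve_left hne
    have hc : c = -2 * ζ * a := by linear_combination ζ * hc' - c * hζ
    subst hc
    have ha4 : a ^ 4 = 1 / 9 := by linear_combination (h₀ - 8 * a ^ 4 * hζ) / 9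
    have hb3 : a * b ^ 3 = -1 / 9 := by
      linear_combination (h₃ - 5 * a * b ^ 3 * hζ) / 9
    refine ⟨.inr (⟨a, ha4⟩, ⟨-(b / a), ?_⟩, ⟨ζ, hζ⟩), ?_⟩
    · have : b ^ 3 = -a ^ 3 := mul_left_cancel₀ ha (by linear_combination hb3 + ha4)
      rw [neg_pow, div_pow, this]
      field_simp
    · simp only [coeffs, Prod.mk.injEq, true_and]
      refine ⟨by field_simp, by field_simp⟩

/-- Index type for the lines on the Schur quartic. -/
abbrev SchurLine : Type := (SchurZero × SchurZero) ⊕ SchurAut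

/-- The first of two vectors spanning the line with a given index. -/
def SchurLine.vec₁ : SchurLine → Fin 4 → ℂ
  | .inl (z, _) => ![z.fst, z.snd, 0, 0]
  | .inr s => ![1, 0, s.coeffs.1, s.coeffs.2.2.1]

/-- The second of two vectors spanning the line with a given index. -/
def SchurLine.vec₂ : SchurLine → Fin 4 → ℂ
  | .inl (_, z) => ![0, 0, z.fst, z.snd]
  | .inr s => ![0, 1, s.coeffs.2.1, s.coeffs.2.2.2]

/-- The line with a given index, as a subspace of `ℂ⁴`. -/
def SchurLine.plane (l : SchurLine) : Submodule ℂ (Fin 4 → ℂ) :=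
  Submodule.span ℂ {l.vec₁, l.vec₂}

lemma SchurLine.linearIndependent (l : SchurLine) : LinearIndependent ℂ ![l.vec₁, l.vec₂] := by
  rw [LinearIndependent.pair_iff]
  intro s t h
  rcases l with ⟨z, z'⟩ | A
  · have h0 := congrFun h 0
    have h1 := congrFun h 1
    have h2 := congrFun h 2
    have h3 := congrFun h 3
    simp [vec₁, vec₂] at h0 h1 h2 h3
    have := z.ne_zero
    have := z'.ne_zero
    tauto
  · have h0 := congrFun h 0
    have h1 := congrFun h 1
    simp [vec₁, vec₂] at h0 h1
    exact ⟨h0, h1⟩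

lemma finrank_span_pair_eq_two {V : Type*} [AddCommGroup V] [Module ℂ V] {u v : V}
    (h : LinearIndependent ℂ ![u, v]) : Module.finrank ℂ (Submodule.span ℂ {u, v}) = 2 := by
  rw [← Matrix.range_cons_cons_empty u v ![], finrank_span_eq_card h, Fintype.card_fin]

lemma eq_span_pair_of_finrank_eq_two {V : Type*} [AddCommGroup V] [Module ℂ V]
    {W : Submodule ℂ V} (hW : Module.finrank ℂ W = 2) {u v : V}
    (h : LinearIndependent ℂ ![u, v]) (hu : u ∈ W) (hv : v ∈ W) :
    Submodule.span ℂ {u, v} = W := by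
  have : FiniteDimensional ℂ W := Module.finite_of_finrank_eq_succ hW
  refine Submodule.eq_of_le_of_finrank_eq (Submodule.span_le.mpr ?_) ?_
  · rintro x (rfl | rfl) <;> assumption
  · rw [finrank_span_pair_eq_two h, hW]

lemma SchurLine.isLineInSurface (l : SchurLine) :
    IsLineInSurface (X 0 ^ 4 - X 0 * X 1 ^ 3 - X 2 ^ 4 + X 2 * X 3 ^ 3 : MvPolynomial (Fin 4) ℂ)
      l.plane := by
  refine ⟨finrank_span_pair_eq_two l.linearIndependent, fun v hv ↦ ?_⟩
  obtain ⟨s, t, rfl⟩ := Submodule.mem_span_pair.mp hv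
  rw [eval_schur]
  rcases l with ⟨z, z'⟩ | A
  · have h := z.schurForm_eq_zero
    have h' := z'.schurForm_eq_zero
    simp only [schurForm] at h h'
    simp [vec₁, vec₂, schurForm]
    linear_combination s ^ 4 * h - t ^ 4 * h'
  · have h := A.preservesSchurForm s t
    simp only [schurForm] at h
    simp [vec₁, vec₂, schurForm]
    linear_combination -h

lemma SchurLine.plane_injective : Function.Injective SchurLine.plane := by
  intro l l' h
  have h₁ : l.vec₁ ∈ l'.plane := h ▸ Submodule.subset_span (by simp)
  have h₂ : l.vec₂ ∈ l'.plane := h ▸ Submodule.subset_span (by simp)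
  have h₃ : l'.vec₂ ∈ l.plane := h ▸ Submodule.subset_span (by simp)
  obtain ⟨s₁, t₁, h₁⟩ := Submodule.mem_span_pair.mp h₁
  obtain ⟨s₂, t₂, h₂⟩ := Submodule.mem_span_pair.mp h₂
  obtain ⟨s₃, t₃, h₃⟩ := Submodule.mem_span_pair.mp h₃
  simp only [funext_iff, Fin.forall_fin_succ] at h₁ h₂ h₃
  rcases l with ⟨z, w⟩ | A <;> rcases l' with ⟨z', w'⟩ | A' <;>
    simp [vec₁, vec₂] at h₁ h₂ h₃
  · rw [SchurZero.eq_of_smul h₁.1 h₁.2.1, SchurZero.eq_of_smul h₂.2.2.1 h₂.2.2.2]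
  · obtain ⟨rfl, rfl, h₂, h₂'⟩ := h₂
    have := w.ne_zero
    simp [← h₂, ← h₂'] at this
  · obtain ⟨rfl, rfl, h₃, h₃'⟩ := h₃
    have := w'.ne_zero
    simp [← h₃, ← h₃'] at this
  · obtain ⟨rfl, rfl, h₁, h₁'⟩ := h₁
    obtain ⟨rfl, rfl, h₂, h₂'⟩ := h₂
    simp at h₁ h₁' h₂ h₂'
    rw [SchurAut.coeffs_injective (Prod.ext h₁.symm
      (Prod.ext h₂.symm (Prod.ext h₁'.symm h₂'.symm)))]

lemma exists_mem_notMem_span_singleton {W : Submodule ℂ (Fin 4 → ℂ)}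
    (hW : Module.finrank ℂ W = 2) (w : Fin 4 → ℂ) :
    ∃ p ∈ W, p ∉ Submodule.span ℂ {w} := by
  by_contra! h
  have h₁ := Submodule.finrank_mono (show W ≤ Submodule.span ℂ {w} from h)
  have h₂ := finrank_span_le_card (R := ℂ) ({w} : Set (Fin 4 → ℂ))
  simp at h₂
  omega

/-- A zero of `schurForm` is simple, so that moving along it from `(r, s)` changes the value of
the form unless `(r, s)` is proportional to it. -/
lemma exists_smul_of_schurForm_const {c d r s k : ℂ} (hcd : c ≠ 0 ∨ d ≠ 0)
    (h₀ : schurForm c d = 0) (h : ∀ t, schurForm (r + t * c) (s + t * d) = k) :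
    ∃ m, r = m * c ∧ s = m * d := by
  simp only [schurForm] at h₀ h
  have key : 4 * c ^ 3 * r - d ^ 3 * r - 3 * c * d ^ 2 * s = 0 := by
    linear_combination (h 2 - 3 * h 1 + 3 * h 0 - h (-1)) / 6 - 2 * h₀
  by_cases hc : c = 0
  · subst hc
    have hd : d ≠ 0 := by simpa using hcd
    have hr : r = 0 := by simpa [hd] using key
    exact ⟨s / d, by simp [hr], by field_simp⟩
  · have hcd3 : d ^ 3 = c ^ 3 := mul_left_cancel₀ hc (by linear_combination -h₀)
    refine ⟨r / c, by field_simp, ?_⟩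
    have : c ^ 4 * (c * s - r * d) = 0 := by
      linear_combination -(d / 3) * c * key - (c ^ 2 * s + c * d * r / 3) * hcd3
    have := (mul_eq_zero.mp this).resolve_left (pow_ne_zero 4 hc)
    field_simp
    linear_combination this

lemma SchurLine.exists_plane_eq_of_mem {W : Submodule ℂ (Fin 4 → ℂ)}
    (hW : Module.finrank ℂ W = 2)
    (hf : ∀ v ∈ W, schurForm (v 0) (v 1) = schurForm (v 2) (v 3))
    {w : Fin 4 → ℂ} (hw : w ∈ W) (hw0 : w ≠ 0) (h0 : w 0 = 0) (h1 : w 1 = 0) :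
    ∃ l : SchurLine, l.plane = W := by
  obtain ⟨p, hp, hpw⟩ := exists_mem_notMem_span_singleton hW w
  have hw23 : w 2 ≠ 0 ∨ w 3 ≠ 0 := by
    by_contra! h
    refine hw0 (funext fun i ↦ ?_)
    fin_cases i <;> simp [h0, h1, h]
  have hφw : schurForm (w 2) (w 3) = 0 := by
    rw [← hf w hw, h0, h1]; simp [schurForm]
  obtain ⟨m, hm₂, hm₃⟩ := exists_smul_of_schurForm_const (r := p 2) (s := p 3)
    (k := schurForm (p 0) (p 1)) hw23 hφw fun t ↦ by
      simpa [h0, h1] using (hf _ (W.add_mem hp (W.smul_mem t hw))).symm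
  have hq : p - m • w ∈ W := W.sub_mem hp (W.smul_mem m hw)
  have hp01 : p 0 ≠ 0 ∨ p 1 ≠ 0 := by
    by_contra! h
    refine hpw (Submodule.mem_span_singleton.mpr ⟨m, funext fun i ↦ ?_⟩)
    fin_cases i <;> simp [h0, h1, h, hm₂, hm₃]
  have hφp : schurForm (p 0) (p 1) = 0 := by
    have := hf _ hq
    simp [h0, h1, hm₂, hm₃] at this
    rw [this]; simp [schurForm]
  obtain ⟨z, k, hk, hz₁, hz₂⟩ := SchurZero.exists_of_schurForm_eq_zero hp01 hφp
  obtain ⟨z', k', hk', hz₁', hz₂'⟩ := SchurZero.exists_of_schurForm_eq_zero hw23 hφw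
  refine ⟨.inl (z, z'), eq_span_pair_of_finrank_eq_two hW (SchurLine.linearIndependent _) ?_ ?_⟩
  · convert W.smul_mem k⁻¹ hq using 1
    ext i
    fin_cases i <;> simp [vec₁, h0, h1, hm₂, hm₃, hz₁, hz₂, hk]
  · convert W.smul_mem k'⁻¹ hw using 1
    ext i
    fin_cases i <;> simp [vec₂, h0, h1, hz₁', hz₂', hk']

lemma SchurLine.exists_plane_eq_of_forall {W : Submodule ℂ (Fin 4 → ℂ)}
    (hW : Module.finrank ℂ W = 2)
    (hf : ∀ v ∈ W, schurForm (v 0) (v 1) = schurForm (v 2) (v 3))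
    (h : ∀ w ∈ W, w 0 = 0 → w 1 = 0 → w = 0) :
    ∃ l : SchurLine, l.plane = W := by
  let π : W →ₗ[ℂ] (Fin 2 → ℂ) := (LinearMap.funLeft ℂ ℂ ![0, 1]).comp W.subtype
  have hinj : Function.Injective π := by
    rw [← LinearMap.ker_eq_bot, LinearMap.ker_eq_bot']
    intro w hw
    have e0 := congrFun hw 0
    have e1 := congrFun hw 1
    exact Subtype.ext (h w w.2 e0 e1)
  have hsurj : Function.Surjective π :=
    (LinearMap.injective_iff_surjective_of_finrank_eq_finrank (by simp [hW])).mp hinj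
  obtain ⟨⟨u, hu⟩, hπu⟩ := hsurj ![1, 0]
  obtain ⟨⟨v, hv⟩, hπv⟩ := hsurj ![0, 1]
  have hu0 : u 0 = 1 := congrFun hπu 0
  have hu1 : u 1 = 0 := congrFun hπu 1
  have hv0 : v 0 = 0 := congrFun hπv 0
  have hv1 : v 1 = 1 := congrFun hπv 1
  obtain ⟨s, hs⟩ := SchurAut.exists_coeffs_eq (A := (u 2, v 2, u 3, v 3)) fun x y ↦ by
    have := hf _ (W.add_mem (W.smul_mem x hu) (W.smul_mem y hv))
    simp [hu0, hu1, hv0, hv1] at this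
    rw [this, mul_comm x, mul_comm y, mul_comm x, mul_comm y]
  refine ⟨.inr s, eq_span_pair_of_finrank_eq_two hW (SchurLine.linearIndependent _) ?_ ?_⟩
  · convert hu using 1
    ext i
    fin_cases i <;> simp [vec₁, hs, hu0, hu1]
  · convert hv using 1
    ext i
    fin_cases i <;> simp [vec₂, hs, hv0, hv1]

lemma SchurLine.range_plane :
    Set.range SchurLine.plane = {W : Submodule ℂ (Fin 4 → ℂ) |
      IsLineInSurface
        (X 0 ^ 4 - X 0 * X 1 ^ 3 - X 2 ^ 4 + X 2 * X 3 ^ 3 : MvPolynomial (Fin 4) ℂ) W} := by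
  ext W
  refine ⟨?_, fun ⟨hW, hf⟩ ↦ ?_⟩
  · rintro ⟨l, rfl⟩
    exact l.isLineInSurface
  · simp only [eval_schur, sub_eq_zero] at hf
    by_cases h : ∀ w ∈ W, w 0 = 0 → w 1 = 0 → w = 0
    · exact exists_plane_eq_of_forall hW hf h
    · push Not at h
      obtain ⟨w, hw, h0, h1, hw0⟩ := h
      exact exists_plane_eq_of_mem hW hf hw hw0 h0 h1

lemma SchurLine.card : Nat.card SchurLine = 64 := by
  have h₃ : Nat.card (PowRoot 3 1) = 3 := PowRoot.card (by norm_num) (by norm_num)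
  have h₄ : Nat.card (PowRoot 4 1) = 4 := PowRoot.card (by norm_num) (by norm_num)
  have h₉ : Nat.card (PowRoot 4 (1 / 9)) = 4 := PowRoot.card (by norm_num) (by norm_num)
  have : Finite (PowRoot 3 1) := Nat.finite_of_card_ne_zero (by simp [h₃])
  have : Finite (PowRoot 4 1) := Nat.finite_of_card_ne_zero (by simp [h₄])
  have : Finite (PowRoot 4 (1 / 9)) := Nat.finite_of_card_ne_zero (by rw [h₉]; norm_num)
  rw [Nat.card_sum, Nat.card_sum, Nat.card_prod, Nat.card_prod, Nat.card_prod, Nat.card_prod,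
    Finite.card_option, h₃, h₄, h₉]

theorem schur_quartic_smooth_and_64_lines :
    IsSmoothSurfaceOfDegree
        (X 0 ^ 4 - X 0 * X 1 ^ 3 - X 2 ^ 4 + X 2 * X 3 ^ 3 : MvPolynomial (Fin 4) ℂ) 4 ∧
      {W : Submodule ℂ (Fin 4 → ℂ) |
        IsLineInSurface
          (X 0 ^ 4 - X 0 * X 1 ^ 3 - X 2 ^ 4 + X 2 * X 3 ^ 3 : MvPolynomial (Fin 4) ℂ)
          W}.ncard = 64 := by
  refine ⟨isSmoothSurfaceOfDegree_schur, ?_⟩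
  rw [← SchurLine.range_plane, Set.ncard_range_of_injective SchurLine.plane_injective,
    SchurLine.card]
end

section
/- Let K be an algebraically closed field of characteristic 0 and let d ≥ 3. The Fermat surface X ⊂ P³(K) defined by x₀^d + x₁^d + x₂^d + x₃^d = 0 is a smooth surface of degree d containing exactly 3d² lines. -/
open MvPolynomial

/-- The line of `ℙ³(K)` cut out by `x (σ 0) = c * x (σ 1)` and `x (σ 2) = e * x (σ 3)`. -/
def pairLine {K : Type*} [Field K] (σ : Equiv.Perm (Fin 4)) (c e : K) :
    Submodule K (Fin 4 → K) where
  carrier := {x | x (σ 0) = c * x (σ 1) ∧ x (σ 2) = e * x (σ 3)}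
  zero_mem' := by simp
  add_mem' := by
    rintro x y ⟨hx, hx'⟩ ⟨hy, hy'⟩
    simp [hx, hx', hy, hy', mul_add]
  smul_mem' := by
    rintro r x ⟨hx, hx'⟩
    simp [hx, hx', mul_left_comm]

section PairLine

variable {K : Type*} [Field K]

theorem mem_pairLine {σ : Equiv.Perm (Fin 4)} {c e : K} {x : Fin 4 → K} :
    x ∈ pairLine σ c e ↔ x (σ 0) = c * x (σ 1) ∧ x (σ 2) = e * x (σ 3) :=
  Iff.rfl

theorem vec_comp_symm_mem_pairLine (σ : Equiv.Perm (Fin 4)) (c e s t : K) :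
    ![c * s, s, e * t, t] ∘ σ.symm ∈ pairLine σ c e := by
  simp [mem_pairLine]

/-- The coordinates `x (σ 1)` and `x (σ 3)` parametrize `pairLine σ c e`. -/
def pairLineEquiv (σ : Equiv.Perm (Fin 4)) (c e : K) : pairLine σ c e ≃ₗ[K] K × K where
  toFun x := (x.1 (σ 1), x.1 (σ 3))
  map_add' _ _ := rfl
  map_smul' _ _ := rfl
  invFun p := ⟨![c * p.1, p.1, e * p.2, p.2] ∘ σ.symm, vec_comp_symm_mem_pairLine σ c e p.1 p.2⟩
  left_inv := by
    rintro ⟨x, hx, hx'⟩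
    ext i
    obtain ⟨k, rfl⟩ := σ.surjective i
    fin_cases k <;> simp [hx, hx']
  right_inv p := by simp

theorem finrank_pairLine (σ : Equiv.Perm (Fin 4)) (c e : K) :
    Module.finrank K (pairLine σ c e) = 2 := by
  simp [(pairLineEquiv σ c e).finrank_eq]

theorem sum_pow_eq_zero_of_mem_pairLine {d : ℕ} {σ : Equiv.Perm (Fin 4)} {c e : K}
    (hc : c ^ d = -1) (he : e ^ d = -1) {x : Fin 4 → K} (hx : x ∈ pairLine σ c e) :
    ∑ i, x i ^ d = 0 := by
  rw [← Equiv.sum_comp σ, Fin.sum_univ_four, hx.1, hx.2, mul_pow, mul_pow, hc, he]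
  ring

theorem pow_eq_neg_one_of_sum_pow_eq_zero {d : ℕ} (hd : d ≠ 0) {σ : Equiv.Perm (Fin 4)} {c e : K}
    (h : ∀ x ∈ pairLine σ c e, ∑ i, x i ^ d = 0) : c ^ d = -1 ∧ e ^ d = -1 := by
  have key (s t : K) : (c * s) ^ d + s ^ d + (e * t) ^ d + t ^ d = 0 := by
    have := h _ (vec_comp_symm_mem_pairLine σ c e s t)
    rw [← Equiv.sum_comp σ] at this
    simpa [Fin.sum_univ_four] using this
  exact ⟨eq_neg_of_add_eq_zero_left (by simpa [hd] using key 1 0),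
    eq_neg_of_add_eq_zero_left (by simpa [hd] using key 0 1)⟩

theorem pairLine_injective (σ : Equiv.Perm (Fin 4)) {c e c' e' : K}
    (h : pairLine σ c e = pairLine σ c' e') : c = c' ∧ e = e' := by
  have h₁ := vec_comp_symm_mem_pairLine σ c e 1 1
  rw [h] at h₁
  simpa [mem_pairLine] using h₁

theorem eq_of_pairLine_swap_eq {m m' : Fin 3} {c e c' e' : K} (hc : c ≠ 0)
    (h : pairLine (Equiv.swap 1 m.succ) c e = pairLine (Equiv.swap 1 m'.succ) c' e') :
    m = m' := by
  by_contra hm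
  have h₁ := vec_comp_symm_mem_pairLine (Equiv.swap 1 m.succ) c e 1 0
  rw [h] at h₁
  fin_cases m <;> fin_cases m' <;>
    simp [mem_pairLine, Equiv.swap_apply_def, hc] at h₁ hm

end PairLine

section Polarization

variable {K : Type*} [Field K] [CharZero K] {ι : Type*} [Fintype ι]

theorem sum_mul_pow_eq_zero {W : Submodule K (ι → K)} {n : ℕ} {α : ι → K}
    (h : ∀ w ∈ W, ∑ i, α i * w i ^ (n + 1) = 0) {a : ι → K} (ha : a ∈ W) :
    ∀ w ∈ W, ∑ i, (α i * a i) * w i ^ n = 0 := by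
  intro w hw
  let p : Polynomial K :=
    ∑ i, Polynomial.C (α i) * (Polynomial.C (w i) + Polynomial.X * Polynomial.C (a i)) ^ (n + 1)
  have hp : p = 0 := Polynomial.funext fun t => by
    simpa [p, Polynomial.eval_finsetSum, mul_comm (a _)] using h (w + t • a) (W.add_mem hw (W.smul_mem t ha))
  have h₁ : p.derivative.eval 0 = 0 := by simp [hp]
  have h₂ : p.derivative.eval 0 = ((n : K) + 1) * ∑ i, (α i * a i) * w i ^ n := by
    simp only [p, Polynomial.derivative_sum, Polynomial.eval_finsetSum, Finset.mul_sum]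
    refine Finset.sum_congr rfl fun i _ => ?_
    simp [Polynomial.derivative_pow]
    ring
  exact (mul_eq_zero.1 (h₂.symm.trans h₁)).resolve_left n.cast_add_one_ne_zero

theorem exists_forall_apply_eq_mul {W : Submodule K (Fin 4 → K)} {d : ℕ} (hd : 3 ≤ d)
    (h : ∀ w ∈ W, ∑ i, w i ^ d = 0) (i : Fin 4) :
    ∃ j ≠ i, ∃ c : K, ∀ x ∈ W, x i = c * x j := by
  by_contra! hcon
  have hker (j : Fin 4) (hj : j ≠ i) : ∃ x ∈ W, x j = 0 ∧ x i ≠ 0 := by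
    by_contra! hW
    by_cases h₀ : ∀ y ∈ W, y j = 0
    · obtain ⟨x, hx, hxi⟩ := hcon j hj 0
      exact hxi (by simpa using hW x hx (h₀ x hx))
    · push Not at h₀
      obtain ⟨y, hy, hyj⟩ := h₀
      obtain ⟨x, hx, hxi⟩ := hcon j hj (y i / y j)
      have := hW (x - (x j / y j) • y) (W.sub_mem hx (W.smul_mem _ hy)) (by simp [hyj])
      refine hxi ?_
      simp only [Pi.sub_apply, Pi.smul_apply, smul_eq_mul] at this
      rw [sub_eq_zero.1 this]
      ring
  choose! a haW ha₀ hai using hker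
  obtain ⟨n, rfl⟩ := Nat.exists_eq_add_of_le' hd
  have hne (k : Fin 3) : i.succAbove k ≠ i := Fin.succAbove_ne i k
  have hW (k : Fin 3) := haW _ (hne k)
  have h₃ := sum_mul_pow_eq_zero (sum_mul_pow_eq_zero (sum_mul_pow_eq_zero (α := 1)
    (by simpa using h) (hW 0)) (hW 1)) (hW 2) _ (hW 0)
  rw [Fin.sum_univ_succAbove _ i, Fin.sum_univ_three] at h₃
  simp [ha₀ _ (hne 0), ha₀ _ (hne 1), ha₀ _ (hne 2), hai _ (hne 0), hai _ (hne 1),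
    hai _ (hne 2)] at h₃

end Polarization

theorem finrank_le_one_of_forall_apply_eq_mul {K ι : Type*} [Field K] {W : Submodule K (ι → K)}
    {j : ι} (h : ∀ i, ∃ c : K, ∀ x ∈ W, x i = c * x j) : Module.finrank K W ≤ 1 := by
  have hinj : Function.Injective ((LinearMap.proj j : (ι → K) →ₗ[K] K) ∘ₗ W.subtype) := by
    rw [injective_iff_map_eq_zero]
    rintro ⟨x, hx⟩ hx₀
    ext i
    obtain ⟨c, hc⟩ := h i
    have hxj : x j = 0 := hx₀
    simp [hc x hx, hxj]
  simpa using LinearMap.finrank_le_finrank_of_injective hinj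

theorem exists_eq_pairLine {K : Type*} [Field K] [CharZero K] {W : Submodule K (Fin 4 → K)}
    {d : ℕ} (hd : 3 ≤ d) (hW : Module.finrank K W = 2) (h : ∀ w ∈ W, ∑ i, w i ^ d = 0) :
    ∃ (m : Fin 3) (c e : K), W = pairLine (Equiv.swap 1 m.succ) c e := by
  have hprop := exists_forall_apply_eq_mul hd h
  obtain ⟨j, hj, c, hc⟩ := hprop 0
  obtain ⟨m, rfl⟩ := Fin.exists_succ_eq.2 hj
  set σ : Equiv.Perm (Fin 4) := Equiv.swap 1 m.succ with hσ
  have h₀ : σ 0 = 0 := Equiv.swap_apply_of_ne_of_ne (by simp) hj.symm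
  have h₁ : σ 1 = m.succ := Equiv.swap_apply_left _ _
  rw [← h₀, ← h₁] at hc
  suffices ∃ e : K, ∀ x ∈ W, x (σ 2) = e * x (σ 3) by
    obtain ⟨e, he⟩ := this
    exact ⟨m, c, e, Submodule.eq_of_le_of_finrank_eq (fun x hx => ⟨hc x hx, he x hx⟩)
      (hW.trans (finrank_pairLine σ c e).symm)⟩
  by_contra! hcon
  have hp₁ : ∃ e : K, ∀ x ∈ W, x (σ 1) = e * x (σ 1) := ⟨1, by simp⟩
  have htrans {k l : Fin 4} (hkl : ∃ e : K, ∀ x ∈ W, x (σ k) = e * x (σ l))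
      (hl : ∃ e : K, ∀ x ∈ W, x (σ l) = e * x (σ 1)) :
      ∃ e : K, ∀ x ∈ W, x (σ k) = e * x (σ 1) := by
    obtain ⟨e, he⟩ := hkl
    obtain ⟨e', he'⟩ := hl
    exact ⟨e * e', fun x hx => by rw [he x hx, he' x hx, mul_assoc]⟩
  have hp₂ : ∃ e : K, ∀ x ∈ W, x (σ 2) = e * x (σ 1) := by
    obtain ⟨k, hk, e, he⟩ := hprop (σ 2)
    obtain ⟨k, rfl⟩ := σ.surjective k
    fin_cases k
    · exact htrans ⟨e, he⟩ ⟨c, hc⟩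
    · exact ⟨e, he⟩
    · exact absurd rfl hk
    · obtain ⟨x, hx, hne⟩ := hcon e
      exact absurd (he x hx) hne
  have hp₃ : ∃ e : K, ∀ x ∈ W, x (σ 3) = e * x (σ 1) := by
    obtain ⟨k, hk, e, he⟩ := hprop (σ 3)
    obtain ⟨k, rfl⟩ := σ.surjective k
    fin_cases k
    · exact htrans ⟨e, he⟩ ⟨c, hc⟩
    · exact ⟨e, he⟩
    · exact htrans ⟨e, he⟩ hp₂
    · exact absurd rfl hk
  have : Module.finrank K W ≤ 1 := finrank_le_one_of_forall_apply_eq_mul (j := σ 1) fun i => by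
    obtain ⟨k, rfl⟩ := σ.surjective i
    fin_cases k
    exacts [⟨c, hc⟩, hp₁, hp₂, hp₃]
  omega

theorem card_nthRootsFinset_of_ne_zero {K : Type*} [Field K] [IsAlgClosed K] [CharZero K] {d : ℕ}
    (hd : d ≠ 0) {a : K} (ha : a ≠ 0) : (Polynomial.nthRootsFinset d a).card = d := by
  classical
  have : NeZero d := ⟨hd⟩
  obtain ⟨ζ, hζ⟩ := HasEnoughRootsOfUnity.exists_primitiveRoot K d
  rw [Polynomial.nthRootsFinset_def, Multiset.toFinset_card_of_nodup (hζ.nthRoots_nodup ha),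
    hζ.card_nthRoots, if_pos (IsAlgClosed.exists_pow_nat_eq a (Nat.pos_of_ne_zero hd))]

theorem isSmoothSurfaceOfDegree_fermat {K : Type*} [Field K] [CharZero K] {d : ℕ} (hd : d ≠ 0) :
    IsSmoothSurfaceOfDegree
      (X 0 ^ d + X 1 ^ d + X 2 ^ d + X 3 ^ d : MvPolynomial (Fin 4) K) d := by
  refine ⟨?_, fun w hw => ?_⟩
  · have h (i : Fin 4) : (X i ^ d : MvPolynomial (Fin 4) K).IsHomogeneous d := by
      simpa using (isHomogeneous_X K i).pow d
    exact (((h 0).add (h 1)).add (h 2)).add (h 3)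
  · obtain ⟨i, hi⟩ := Function.ne_iff.1 hw
    refine ⟨i, ?_⟩
    have : eval w (pderiv i (X 0 ^ d + X 1 ^ d + X 2 ^ d + X 3 ^ d : MvPolynomial (Fin 4) K)) =
        d * w i ^ (d - 1) := by
      fin_cases i <;> simp [pderiv_X]
    rw [this]
    exact mul_ne_zero (Nat.cast_ne_zero.2 hd) (pow_ne_zero _ hi)

theorem fermat_surface_smooth_and_lines_count
    {K : Type*} [Field K] [IsAlgClosed K] [CharZero K] (d : ℕ) (hd : 3 ≤ d) :
    IsSmoothSurfaceOfDegree
        (X 0 ^ d + X 1 ^ d + X 2 ^ d + X 3 ^ d : MvPolynomial (Fin 4) K) d ∧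
      {W : Submodule K (Fin 4 → K) |
        IsLineInSurface (X 0 ^ d + X 1 ^ d + X 2 ^ d + X 3 ^ d : MvPolynomial (Fin 4) K)
          W}.ncard = 3 * d ^ 2 := by
  have hd₀ : d ≠ 0 := by omega
  refine ⟨isSmoothSurfaceOfDegree_fermat hd₀, ?_⟩
  set S := Polynomial.nthRootsFinset d (-1 : K)
  have hS {c : K} : c ∈ S ↔ c ^ d = -1 := Polynomial.mem_nthRootsFinset (by omega) _
  let L : Fin 3 × K × K → Submodule K (Fin 4 → K) :=
    fun p => pairLine (Equiv.swap 1 p.1.succ) p.2.1 p.2.2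
  let T : Finset (Fin 3 × K × K) := Finset.univ ×ˢ S ×ˢ S
  have hset : {W : Submodule K (Fin 4 → K) | IsLineInSurface
      (X 0 ^ d + X 1 ^ d + X 2 ^ d + X 3 ^ d : MvPolynomial (Fin 4) K) W} = L '' T := by
    ext W
    have heval : IsLineInSurface
        (X 0 ^ d + X 1 ^ d + X 2 ^ d + X 3 ^ d : MvPolynomial (Fin 4) K) W ↔
        Module.finrank K W = 2 ∧ ∀ w ∈ W, ∑ i, w i ^ d = 0 := by
      simp [IsLineInSurface, Fin.sum_univ_four]
    rw [Set.mem_ofPred_eq, heval]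
    constructor
    · rintro ⟨hW, h⟩
      obtain ⟨m, c, e, rfl⟩ := exists_eq_pairLine hd hW h
      obtain ⟨hc, he⟩ := pow_eq_neg_one_of_sum_pow_eq_zero hd₀ h
      exact ⟨(m, c, e), by simp [T, hS, hc, he], rfl⟩
    · rintro ⟨⟨m, c, e⟩, hT, rfl⟩
      simp only [T, Finset.coe_product, Set.mem_prod, Finset.mem_coe, hS] at hT
      exact ⟨finrank_pairLine _ _ _,
        fun x hx => sum_pow_eq_zero_of_mem_pairLine hT.2.1 hT.2.2 hx⟩
  have hinj : Set.InjOn L T := by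
    rintro ⟨m, c, e⟩ hT ⟨m', c', e'⟩ - h
    simp only [T, Finset.coe_product, Set.mem_prod, Finset.mem_coe, hS] at hT
    have hc : c ≠ 0 := by
      rintro rfl
      simp [hd₀] at hT
    obtain rfl := eq_of_pairLine_swap_eq hc h
    obtain ⟨rfl, rfl⟩ := pairLine_injective _ h
    rfl
  rw [hset, hinj.ncard_image, Set.ncard_coe_finset, Finset.card_product, Finset.card_product,
    card_nthRootsFinset_of_ne_zero hd₀ (neg_ne_zero.2 one_ne_zero), Finset.card_univ,
    Fintype.card_fin, sq]
end

section
/- Let X = {f = 0} ⊂ P³(K) be a smooth surface of degree d ≥ 3 over an algebraically closed field K of characteristic 0 or of characteristic p > d. Suppose C ⊆ X is an infinite subset such that for every P ∈ C the form t_P^(2) vanishes identically on the projective tangent plane T_P X. Then there exist two points P, Q ∈ C with P ≠ Q and T_P X = T_Q X is false; that is, such a configuration cannot occur: the set of points P ∈ X with t_P^(2) vanishing identically on T_P X is finite. -/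
open MvPolynomial

namespace MvPolynomial

theorem pderiv_pderiv_comm {R σ : Type*} [CommRing R] (i j : σ) (f : MvPolynomial σ R) :
    pderiv i (pderiv j f) = pderiv j (pderiv i f) := by
  classical
  have h : ⁅pderiv (R := R) i, pderiv (R := R) j⁆ = 0 := by
    refine derivation_ext fun k => ?_
    rw [Derivation.commutator_apply]
    simp [pderiv_X, Pi.single_apply, apply_ite]
  have h' := congrArg (fun D => D f) h
  simpa [Derivation.commutator_apply, sub_eq_zero] using h'

/-- A homogeneous element of an ideal generated by homogeneous polynomials of degree `e` is a
combination of the generators with homogeneous coefficients. -/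
theorem IsHomogeneous.exists_homogeneous_coeff {R σ ι : Type*} [CommRing R] [Fintype ι]
    {g : ι → MvPolynomial σ R} {e n : ℕ} (hg : ∀ s, (g s).IsHomogeneous e) (hen : e ≤ n)
    {q : MvPolynomial σ R} (hq : q.IsHomogeneous n) (hmem : q ∈ Ideal.span (Set.range g)) :
    ∃ c : ι → MvPolynomial σ R, (∀ s, (c s).IsHomogeneous (n - e)) ∧ q = ∑ s, c s * g s := by
  classical
  let _ := gradedAlgebra (σ := σ) (R := R)
  obtain ⟨c, hc⟩ := (Submodule.mem_span_range_iff_exists_fun _).1 hmem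
  let D (m : ℕ) : MvPolynomial σ R →+ MvPolynomial σ R :=
    GradedRing.proj (homogeneousSubmodule σ R) m
  refine ⟨fun s => D (n - e) (c s), fun s =>
    (DirectSum.decompose (homogeneousSubmodule σ R) (c s) (n - e)).2, ?_⟩
  have hq' : D n q = q :=
    DirectSum.decompose_of_mem_same (homogeneousSubmodule σ R) hq
  rw [← hq', ← hc, map_sum]
  exact Finset.sum_congr rfl fun s _ =>
    DirectSum.coe_decompose_mul_of_right_mem_of_le (homogeneousSubmodule σ R) (hg s) hen

theorem IsHomogeneous.mem_span_X_pow {R σ : Type*} [CommRing R] {q : MvPolynomial σ R} {n : ℕ}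
    (hq : q.IsHomogeneous n) :
    q ∈ Ideal.span (Set.range (X : σ → MvPolynomial σ R)) ^ n := by
  rw [Ideal.mem_span_pow_iff_exists_isHomogeneous]
  exact ⟨map C q, hq.map C, by rw [eval_map, eval₂_eta]⟩

/-- If polynomials have no common zero other than the origin, then all forms of sufficiently high
degree lie in the ideal they generate. -/
theorem exists_forall_isHomogeneous_mem_span {K σ ι : Type*} [Field K] [IsAlgClosed K] [Finite σ]
    (g : ι → MvPolynomial σ K) (hg : ∀ w : σ → K, w ≠ 0 → ∃ s, eval w (g s) ≠ 0) :
    ∃ k : ℕ, ∀ n, k ≤ n → ∀ q : MvPolynomial σ K, q.IsHomogeneous n →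
      q ∈ Ideal.span (Set.range g) := by
  have hle : Ideal.span (Set.range (X : σ → MvPolynomial σ K)) ≤
      (Ideal.span (Set.range g)).radical := by
    rw [← vanishingIdeal_zeroLocus_eq_radical (K := K), Ideal.span_le]
    rintro _ ⟨i, rfl⟩ w hw
    have : w = 0 := by
      by_contra h
      obtain ⟨s, hs⟩ := hg w h
      exact hs (hw (g s) (Ideal.subset_span ⟨s, rfl⟩))
    simp [this]
  obtain ⟨k, hk⟩ := Ideal.exists_pow_le_of_le_radical_of_fg hle
    (Submodule.fg_span (Set.finite_range _))
  exact ⟨k, fun n hn q hq => hk (Ideal.pow_le_pow_right hn hq.mem_span_X_pow)⟩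

end MvPolynomial

/-- A symmetric bilinear form whose quadratic form vanishes on the kernel of a nonzero covector `l`
is a symmetric product of `l` with another covector. -/
theorem exists_symm_mul_of_vanishing_on_ker {K n : Type*} [Field K] [Fintype n]
    (h2 : (2 : K) ≠ 0) {l : n → K} (hl : l ≠ 0) {H : n → n → K} (hH : ∀ i j, H i j = H j i)
    (h : ∀ z : n → K, ∑ i, l i * z i = 0 → ∑ i, ∑ j, H i j * (z i * z j) = 0) :
    ∃ b : n → K, ∀ i j, H i j = l i * b j + l j * b i := by
  classical
  obtain ⟨s, hs⟩ := Function.ne_iff.1 hl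
  simp only [Pi.zero_apply] at hs
  let B : LinearMap.BilinForm K (n → K) := Matrix.toBilin' (Matrix.of H)
  have hB (x y : n → K) : B x y = ∑ i, ∑ j, H i j * (x i * y j) := by
    simp only [B, Matrix.toBilin'_apply, Matrix.of_apply]
    exact Finset.sum_congr rfl fun i _ => Finset.sum_congr rfl fun j _ => by ring
  let e (i : n) : n → K := Pi.single i 1
  have hBe (i j : n) : B (e i) (e j) = H i j := by
    simp [B, e, Matrix.toBilin'_single]
  let v (i : n) : n → K := l s • e i - l i • e s
  have hv (i : n) : ∑ k, l k * v i k = 0 := by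
    simp [v, e, Pi.single_apply, mul_sub, Finset.sum_sub_distrib, mul_comm]
  have hvv (i j : n) : B (v i) (v j) = 0 := by
    have hQ (z : n → K) (hz : ∑ k, l k * z k = 0) : B z z = 0 := by rw [hB]; exact h z hz
    have hadd := hQ (v i + v j) (by simp [mul_add, Finset.sum_add_distrib, hv])
    have hsymm : B (v j) (v i) = B (v i) (v j) := by
      rw [hB, hB, Finset.sum_comm]
      exact Finset.sum_congr rfl fun a _ => Finset.sum_congr rfl fun c _ => by
        rw [hH c a, mul_comm (v j c)]
    simp only [map_add, LinearMap.add_apply, hQ _ (hv i), hQ _ (hv j), hsymm] at hadd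
    have : 2 * B (v i) (v j) = 0 := by linear_combination hadd
    exact (mul_eq_zero.1 this).resolve_left h2
  refine ⟨fun j => (l s * H s j - l j * H s s / 2) / l s ^ 2, fun i j => ?_⟩
  have hij := hvv i j
  simp only [v, map_sub, map_smul, LinearMap.sub_apply, LinearMap.smul_apply, smul_eq_mul,
    hBe] at hij
  rw [hH i s] at hij
  field_simp
  linear_combination 2 * hij

/-- If a family of nonzero covectors `b x` is such that multiplication by each `b x j * u x i`
preserves the forms of degree `N` restricted to the points `u x`, then the points `u x` span only
finitely many lines. -/
theorem finite_range_span_singleton_of_mul_homogeneous {K σ ι : Type*} [Field K] [Finite σ]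
    {u b : ι → σ → K} (hu : ∀ x, u x ≠ 0) (hb : ∀ x, b x ≠ 0) (N : ℕ)
    (h : ∀ i j, ∀ q : MvPolynomial σ K, q.IsHomogeneous N → ∃ r : MvPolynomial σ K,
      r.IsHomogeneous N ∧ ∀ x, b x j * u x i * eval (u x) q = eval (u x) r) :
    (Set.range fun x => Submodule.span K {u x}).Finite := by
  let E : MvPolynomial σ K →ₗ[K] (ι → K) := LinearMap.pi fun x => (aeval (u x)).toLinearMap
  have hE (q : MvPolynomial σ K) (x : ι) : E q x = eval (u x) q := by
    simp [E, aeval_eq_eval]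
  let A : Submodule K (ι → K) := (homogeneousSubmodule σ K N).map E
  have : Module.Finite K A :=
    Module.Finite.iff_fg.2 ((homogeneousSubmodule_fg (σ := σ) (R := K) N).map E)
  have key (i j : σ) : (Set.range fun x => b x j * u x i).Finite := by
    let φ : ι → K := fun x => b x j * u x i
    have hφ : ∀ a ∈ A, LinearMap.mulLeft K φ a ∈ A := by
      rintro _ ⟨q, hq, rfl⟩
      obtain ⟨r, hr, hqr⟩ := h i j q hq
      refine ⟨r, hr, funext fun x => ?_⟩
      simp only [hE, LinearMap.mulLeft_apply, Pi.mul_apply, φ, hqr]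
    let M : Module.End K A := (LinearMap.mulLeft K φ).restrict hφ
    have hM (p : Polynomial K) (a : A) (x : ι) :
        ((Polynomial.aeval M p a : A) : ι → K) x = p.eval (φ x) * (a : ι → K) x := by
      induction p using Polynomial.induction_on' with
      | add p q hp hq => simp [hp, hq, add_mul]
      | monomial n c =>
        have hpow : ((M ^ n) a : ι → K) x = φ x ^ n * (a : ι → K) x := by
          induction n with
          | zero => simp
          | succ n ih =>
            rw [pow_succ', Module.End.mul_apply]
            simp only [M, LinearMap.coe_restrict_apply, LinearMap.mulLeft_apply, Pi.mul_apply]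
            rw [show (((LinearMap.mulLeft K φ).restrict hφ ^ n) a : ι → K) x = _ from ih]
            ring
        simp [Polynomial.aeval_monomial, Module.algebraMap_end_apply, hpow, mul_assoc]
    refine ((minpoly K M).rootSet_finite K).subset ?_
    rintro _ ⟨x, rfl⟩
    rw [Polynomial.mem_rootSet]
    refine ⟨minpoly.ne_zero (Algebra.IsIntegral.isIntegral M), ?_⟩
    obtain ⟨k, hk⟩ := Function.ne_iff.1 (hu x)
    have hX : E (X k ^ N) ∈ A := ⟨X k ^ N, isHomogeneous_X_pow k N, rfl⟩
    have := hM (minpoly K M) ⟨_, hX⟩ x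
    have h0 : Polynomial.aeval M (minpoly K M) = 0 := minpoly.aeval K M
    rw [h0] at this
    simp only [LinearMap.zero_apply, Submodule.coe_zero, Pi.zero_apply, hE, map_pow, eval_X] at this
    simpa using (mul_eq_zero.1 this.symm).resolve_right (pow_ne_zero _ hk)
  let Φ : ι → σ → σ → K := fun x j i => b x j * u x i
  have hΦ : (Set.range Φ).Finite := by
    refine (Set.Finite.pi' fun j => Set.Finite.pi' fun i => key i j).subset ?_
    rintro _ ⟨x, rfl⟩ j i
    exact ⟨x, rfl⟩
  refine (hΦ.image fun m => Submodule.span K (Set.range m)).subset ?_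
  rintro _ ⟨x, rfl⟩
  refine ⟨Φ x, ⟨x, rfl⟩, le_antisymm (Submodule.span_le.2 ?_) (Submodule.span_le.2 ?_)⟩
  · rintro _ ⟨j, rfl⟩
    exact Submodule.mem_span_singleton.2 ⟨b x j, rfl⟩
  · obtain ⟨j, hj⟩ := Function.ne_iff.1 (hb x)
    rintro _ rfl
    have : u x = (b x j)⁻¹ • Φ x j := by
      funext i
      simp only [Φ, Pi.smul_apply, smul_eq_mul]
      rw [inv_mul_cancel_left₀ hj]
    rw [this]
    exact Submodule.smul_mem _ _ (Submodule.subset_span ⟨j, rfl⟩)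

theorem eval_tForm_one {K : Type*} [CommSemiring K] (f : MvPolynomial (Fin 4) K)
    (u z : Fin 4 → K) :
    eval z (tForm f 1 u) = ∑ i, eval u (pderiv i f) * z i := by
  rw [tForm, map_sum, ← (Equiv.funUnique (Fin 1) (Fin 4)).symm.sum_comp]
  simp

theorem eval_tForm_two {K : Type*} [CommSemiring K] (f : MvPolynomial (Fin 4) K)
    (u z : Fin 4 → K) :
    eval z (tForm f 2 u) = ∑ i, ∑ j, eval u (pderiv i (pderiv j f)) * (z i * z j) := by
  rw [tForm, map_sum, ← (finTwoArrowEquiv (Fin 4)).symm.sum_comp, Fintype.sum_prod_type]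
  simp [List.ofFn_succ, Fin.prod_univ_two]

theorem degenerate_second_fundamental_form_points_finite
    {K : Type*} [Field K] [IsAlgClosed K] (d : ℕ) (hd : 3 ≤ d)
    (hchar : ringChar K = 0 ∨ d < ringChar K)
    (f : MvPolynomial (Fin 4) K) (hf : IsSmoothSurfaceOfDegree f d) :
    {P : Submodule K (Fin 4 → K) | ∃ u : Fin 4 → K, u ≠ 0 ∧ P = Submodule.span K {u} ∧
      MvPolynomial.eval u f = 0 ∧
      ∀ z : Fin 4 → K, MvPolynomial.eval z (tForm f 1 u) = 0 →
        MvPolynomial.eval z (tForm f 2 u) = 0}.Finite := by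
  obtain ⟨hom, smooth⟩ := hf
  have hcast (m : ℕ) (hm0 : 0 < m) (hmd : m ≤ d) : (m : K) ≠ 0 := fun h0 => by
    have hdvd := (ringChar.spec K m).1 h0
    rcases hchar with h | h
    · rw [h, zero_dvd_iff] at hdvd
      omega
    · exact absurd (Nat.le_of_dvd hm0 hdvd) (by omega)
  have h2 : (2 : K) ≠ 0 := by exact_mod_cast hcast 2 (by omega) (by omega)
  let L (i : Fin 4) : MvPolynomial (Fin 4) K := pderiv i f
  let H (i j : Fin 4) : MvPolynomial (Fin 4) K := pderiv i (pderiv j f)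
  have hL (i : Fin 4) : (L i).IsHomogeneous (d - 1) := hom.pderiv
  have hH (i j : Fin 4) : (H i j).IsHomogeneous (d - 1 - 1) := (hL j).pderiv
  let S : Type _ := {u : Fin 4 → K // u ≠ 0 ∧ ∀ z : Fin 4 → K,
    eval z (tForm f 1 u) = 0 → eval z (tForm f 2 u) = 0}
  have hl (x : S) : (fun i => eval x.1 (L i)) ≠ 0 := by
    obtain ⟨i, hi⟩ := smooth x.1 x.2.1
    exact Function.ne_iff.2 ⟨i, hi⟩
  have hex (x : S) : ∃ b : Fin 4 → K, ∀ i j,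
      eval x.1 (H i j) = eval x.1 (L i) * b j + eval x.1 (L j) * b i := by
    refine exists_symm_mul_of_vanishing_on_ker h2 (hl x)
      (fun i j => by simp only [H]; rw [pderiv_pderiv_comm]) fun z hz => ?_
    have := x.2.2 z (by rw [eval_tForm_one]; exact hz)
    rwa [eval_tForm_two] at this
  choose b hb using hex
  have hb0 (x : S) : b x ≠ 0 := fun h0 => by
    obtain ⟨i, hi⟩ := smooth x.1 x.2.1
    have euler := congrArg (eval x.1) (hL i).sum_X_mul_pderiv
    have hz (j : Fin 4) : eval x.1 (pderiv j (L i)) = 0 := by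
      simpa [h0] using hb x j i
    simp only [map_sum, map_mul, hz, mul_zero, Finset.sum_const_zero,
      nsmul_eq_mul, map_natCast] at euler
    exact mul_ne_zero (hcast (d - 1) (by omega) (by omega)) hi euler.symm
  obtain ⟨k, hk⟩ := exists_forall_isHomogeneous_mem_span (fun i => L i ^ 2) fun w hw => by
    obtain ⟨i, hi⟩ := smooth w hw
    exact ⟨i, by simpa [L] using hi⟩
  have hfin := finite_range_span_singleton_of_mul_homogeneous (u := fun x : S => x.1) (b := b)
    (fun x => x.2.1) hb0 (k + (d - 1) * 2) fun i j q hq => by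
      obtain ⟨c, hc, rfl⟩ := hq.exists_homogeneous_coeff (fun s => (hL s).pow 2)
        (Nat.le_add_left _ _) (hk _ (Nat.le_add_right _ _) q hq)
      refine ⟨∑ s, c s * (L s * H s j - C (2⁻¹) * (L j * H s s)) * X i,
        IsHomogeneous.sum _ _ _ fun s _ => ?_, fun x => ?_⟩
      · have h1 := ((hL s).mul (hH s j)).sub (((hL j).mul (hH s s)).C_mul 2⁻¹)
        have h3 := ((hc s).mul h1).mul (isHomogeneous_X K i)
        rwa [show k + (d - 1) * 2 - (d - 1) * 2 + (d - 1 + (d - 1 - 1)) + 1 = k + (d - 1) * 2 by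
          omega] at h3
      · simp only [map_sum, map_mul, map_sub, map_pow, eval_X, eval_C, Finset.mul_sum]
        refine Finset.sum_congr rfl fun s _ => ?_
        rw [hb x s j, hb x s s]
        field_simp
        ring
  refine hfin.subset ?_
  rintro _ ⟨u, hu, rfl, -, hflat⟩
  exact ⟨⟨u, hu, hflat⟩, rfl⟩
end
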